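/- arXiv:1808.04320 — 2 statements merged into one kernel-verified Lean document; each statement's English description precedes it below -/
import Mathlib

section
/- Iterated factorization identity: fix a vector I ∈ ℝ^{n+2} and integers t ≥ 1, k ≥ 1. Define, for each integer j ≥ 1, the operator 𝔅_j := I·D − (1/j)(P·D)(I·∂_P) on smooth functions of (X,P) ∈ ℝ^{n+2} × ℝ^{n+2}. Then, as operators, 𝔅_{t+k−1} ∘ 𝔅_{t+k−2} ∘ ⋯ ∘ 𝔅_t ∘ (P·D)^t = (−1)^k ((t−1)!/(t+k−1)!) (P·D)^{t+k} ∘ (I·∂_P)^k. -/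
noncomputable section

/-- Partial derivative in the `X` variable, direction `A`, of a function `Φ(X,P)`. -/
def pdX {m : ℕ} (A : Fin m) (Φ : (Fin m → ℝ) → (Fin m → ℝ) → ℝ) :
    (Fin m → ℝ) → (Fin m → ℝ) → ℝ :=
  fun x p => fderiv ℝ (fun y => Φ y p) x (Pi.single A 1)

/-- Partial derivative in the `P` variable, direction `A`, of a function `Φ(X,P)`. -/
def pdP {m : ℕ} (A : Fin m) (Φ : (Fin m → ℝ) → (Fin m → ℝ) → ℝ) :
    (Fin m → ℝ) → (Fin m → ℝ) → ℝ :=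
  fun x p => fderiv ℝ (Φ x) p (Pi.single A 1)

/-- The Euler operator `X·∂_X`. -/
def eulerX {m : ℕ} (Φ : (Fin m → ℝ) → (Fin m → ℝ) → ℝ) :
    (Fin m → ℝ) → (Fin m → ℝ) → ℝ :=
  fun x p => ∑ A, x A * pdX A Φ x p

/-- The ambient Laplacian `□_X = η^{AB} ∂_{X^A} ∂_{X^B}` for the diagonal metric `ε`. -/
def lapX {m : ℕ} (ε : Fin m → ℝ) (Φ : (Fin m → ℝ) → (Fin m → ℝ) → ℝ) :
    (Fin m → ℝ) → (Fin m → ℝ) → ℝ :=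
  fun x p => ∑ A, ε A * pdX A (pdX A Φ) x p

/-- `ε` is a diagonal metric with all entries `±1` and exactly `q` entries equal to `-1`,
i.e. a nondegenerate symmetric bilinear form of signature `(m - q, q)`. -/
def isSig {m : ℕ} (ε : Fin m → ℝ) (q : ℕ) : Prop :=
  (∀ A, ε A = 1 ∨ ε A = -1) ∧ Nat.card {A : Fin m // ε A = -1} = q

/-- The flat Thomas-D operator `D_A = 2(X·∂_X + c)∂_{X^A} - X_A □_X` acting in the `X`
variable (with `c = n/2`). -/
def thomasDX {m : ℕ} (ε : Fin m → ℝ) (c : ℝ) (A : Fin m)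
    (Φ : (Fin m → ℝ) → (Fin m → ℝ) → ℝ) : (Fin m → ℝ) → (Fin m → ℝ) → ℝ :=
  fun x p => 2 * (eulerX (pdX A Φ) x p + c * pdX A Φ x p) - ε A * x A * lapX ε Φ x p

/-- The operator `P·D = P_A D^A` (`P` acting by multiplication). -/
def opPD {m : ℕ} (ε : Fin m → ℝ) (c : ℝ) (Φ : (Fin m → ℝ) → (Fin m → ℝ) → ℝ) :
    (Fin m → ℝ) → (Fin m → ℝ) → ℝ :=
  fun x p => ∑ A, p A * thomasDX ε c A Φ x p

/-- The operator `I·D = I^A D_A` for a fixed ambient vector `I`. -/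
def opID {m : ℕ} (ε : Fin m → ℝ) (c : ℝ) (I : Fin m → ℝ)
    (Φ : (Fin m → ℝ) → (Fin m → ℝ) → ℝ) : (Fin m → ℝ) → (Fin m → ℝ) → ℝ :=
  fun x p => ∑ A, I A * thomasDX ε c A Φ x p

/-- The operator `I·∂_P = I^A ∂_{P^A}` for a fixed ambient vector `I`. -/
def opIdP {m : ℕ} (I : Fin m → ℝ) (Φ : (Fin m → ℝ) → (Fin m → ℝ) → ℝ) :
    (Fin m → ℝ) → (Fin m → ℝ) → ℝ :=
  fun x p => ∑ A, I A * pdP A Φ x p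

/-- The operator `𝔅_j = I·D - (1/j)(P·D)(I·∂_P)`. -/
def opB {m : ℕ} (ε : Fin m → ℝ) (c : ℝ) (I : Fin m → ℝ) (j : ℕ)
    (Φ : (Fin m → ℝ) → (Fin m → ℝ) → ℝ) : (Fin m → ℝ) → (Fin m → ℝ) → ℝ :=
  fun x p => opID ε c I Φ x p - (1 / (j : ℝ)) * opPD ε c (opIdP I Φ) x p

/-- The composition `𝔅_{t+k-1} ∘ 𝔅_{t+k-2} ∘ ⋯ ∘ 𝔅_t` (`k` factors). -/
def opBcomp {m : ℕ} (ε : Fin m → ℝ) (c : ℝ) (I : Fin m → ℝ) (t : ℕ) :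
    ℕ → ((Fin m → ℝ) → (Fin m → ℝ) → ℝ) → (Fin m → ℝ) → (Fin m → ℝ) → ℝ
  | 0, Φ => Φ
  | k + 1, Φ => opB ε c I (t + k) (opBcomp ε c I t k Φ)

section Weyl

variable {R : Type*} [Ring R] {m : ℕ}

/-- The Euler element `∑ x_A d_A` of a Weyl-type algebra. -/
def weylEuler (x d : Fin m → R) : R := ∑ A, x A * d A

theorem mul_weylEuler {x d : Fin m → R} (hdd : ∀ A B, Commute (d A) (d B))
    (hdx : ∀ A B, d A * x B = x B * d A + if A = B then 1 else 0) (A : Fin m) :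
    d A * weylEuler x d = weylEuler x d * d A + d A := by
  simp only [weylEuler, Finset.mul_sum, Finset.sum_mul, ← mul_assoc, hdx, add_mul, ite_mul,
    one_mul, zero_mul, Finset.sum_add_distrib, Finset.sum_ite_eq, Finset.mem_univ, if_true]
  simp only [mul_assoc, (hdd A _).eq]

variable [Algebra ℝ R]

/-- The Laplacian `∑ ε_A d_A²` of a Weyl-type algebra. -/
def weylLap (ε : Fin m → ℝ) (d : Fin m → R) : R := ∑ A, ε A • (d A * d A)

/-- The Thomas-D element of a Weyl-type algebra. -/
def weylThomas (ε : Fin m → ℝ) (c : ℝ) (x d : Fin m → R) (A : Fin m) : R :=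
  (2 : ℝ) • (weylEuler x d * d A + c • d A) - ε A • (x A * weylLap ε d)

theorem commute_weylLap (ε : Fin m → ℝ) {d : Fin m → R} {b : R}
    (h : ∀ A, Commute b (d A)) : Commute b (weylLap ε d) :=
  Commute.sum_right _ _ _ fun A _ => ((h A).mul_right (h A)).smul_right _

theorem commute_weylThomas (ε : Fin m → ℝ) (c : ℝ) {x d : Fin m → R} {b : R}
    (hx : ∀ A, Commute b (x A)) (hd : ∀ A, Commute b (d A)) (A : Fin m) :
    Commute b (weylThomas ε c x d A) := by
  have hL : Commute b (weylEuler x d) :=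
    Commute.sum_right _ _ _ fun A _ => (hx A).mul_right (hd A)
  exact (((hL.mul_right (hd A)).add_right ((hd A).smul_right _)).smul_right _).sub_right
    (((hx A).mul_right (commute_weylLap ε hd)).smul_right _)

variable {x d : Fin m → R}

theorem weylLap_mul (ε : Fin m → ℝ)
    (hdx : ∀ A B, d A * x B = x B * d A + if A = B then 1 else 0) (B : Fin m) :
    weylLap ε d * x B = x B * weylLap ε d + (2 * ε B) • d B := by
  have h (A : Fin m) : ε A • (d A * d A) * x B
      = x B * (ε A • (d A * d A)) + if A = B then (2 * ε B) • d B else 0 := by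
    rw [smul_mul_assoc, mul_assoc, hdx, mul_add, ← mul_assoc, hdx, add_mul]
    split_ifs with h
    · subst h
      simp only [mul_one, one_mul, mul_smul_comm, mul_assoc]
      module
    · simp [mul_assoc]
  simp only [weylLap, Finset.sum_mul, h, Finset.sum_add_distrib, Finset.mul_sum,
    Finset.sum_ite_eq', Finset.mem_univ, if_true]

theorem weylLap_mul_weylEuler (ε : Fin m → ℝ) (hdd : ∀ A B, Commute (d A) (d B))
    (hdx : ∀ A B, d A * x B = x B * d A + if A = B then 1 else 0) :
    weylLap ε d * weylEuler x d = weylEuler x d * weylLap ε d + (2 : ℝ) • weylLap ε d := by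
  have h (A : Fin m) : ε A • (d A * d A) * weylEuler x d
      = weylEuler x d * (ε A • (d A * d A)) + (2 : ℝ) • (ε A • (d A * d A)) := by
    rw [smul_mul_assoc, mul_assoc, mul_weylEuler hdd hdx, mul_add, ← mul_assoc,
      mul_weylEuler hdd hdx, add_mul, mul_smul_comm, mul_assoc]
    module
  rw [weylLap, Finset.sum_mul, Finset.mul_sum, Finset.smul_sum, ← Finset.sum_add_distrib]
  exact Finset.sum_congr rfl fun A _ => h A

/-- The Thomas-D elements commute with each other. -/
theorem weylThomas_commute (ε : Fin m → ℝ) (c : ℝ) (hε : ∀ A, ε A * ε A = 1)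
    (hdd : ∀ A B, Commute (d A) (d B)) (hxx : ∀ A B, Commute (x A) (x B))
    (hdx : ∀ A B, d A * x B = x B * d A + if A = B then 1 else 0) (A B : Fin m) :
    Commute (weylThomas ε c x d A) (weylThomas ε c x d B) := by
  rcases eq_or_ne A B with rfl | hAB
  · exact Commute.refl _
  have hAx : d A * x B = x B * d A := by simpa [hAB] using hdx A B
  have hBx : d B * x A = x A * d B := by simpa [hAB.symm] using hdx B A
  have hQx := weylLap_mul ε hdx
  have hQL := weylLap_mul_weylEuler ε hdd hdx
  have hdL := mul_weylEuler hdd hdx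
  have hQd (A : Fin m) : weylLap ε d * d A = d A * weylLap ε d :=
    (commute_weylLap ε (hdd A)).eq.symm
  have hLx (A : Fin m) : weylEuler x d * x A = x A * weylEuler x d + x A := by
    have h (C : Fin m) : x C * d C * x A = x A * (x C * d C) + if C = A then x C else 0 := by
      rw [mul_assoc, hdx, mul_add, ← mul_assoc, (hxx C A).eq, mul_assoc]
      split_ifs <;> simp
    simp only [weylEuler, Finset.sum_mul, h, Finset.sum_add_distrib, Finset.mul_sum,
      Finset.sum_ite_eq', Finset.mem_univ, if_true]
  have hεA := hε A
  have hεB := hε B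
  unfold weylThomas
  generalize weylLap ε d = Q at *
  generalize weylEuler x d = L at *
  have assoc {a b e : R} (h : a * b = e) (r : R) : a * (b * r) = e * r := by
    rw [← mul_assoc, h]
  have hBA := (hdd B A).eq
  have hxBA := (hxx B A).eq
  rw [commute_iff_eq]
  simp only [mul_sub, sub_mul, mul_add, add_mul, smul_mul_assoc, mul_smul_comm, mul_assoc,
    smul_add, smul_sub,
    hQd, hBA, assoc hAx, assoc hBx, assoc (hQx _), assoc hQL, assoc (hdL _), assoc (hLx _),
    assoc hxBA]
  match_scalars <;> grind

end Weyl

section Factorization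

variable {R : Type*} [Ring R] [Algebra ℝ R] {a T S : R}

theorem mul_pow_of_bracket (haT : a * T = T * a + S) (hST : Commute S T) (j : ℕ) :
    a * T ^ (j + 1) = T ^ (j + 1) * a + ((j : ℝ) + 1) • (S * T ^ j) := by
  induction j with
  | zero => simp [haT]
  | succ j ih =>
    rw [pow_succ, ← mul_assoc, ih, add_mul, mul_assoc _ a, haT, mul_add, ← (hST.pow_right _).eq,
      smul_mul_assoc, mul_assoc S, ← pow_succ, ← mul_assoc, ← pow_succ]
    push_cast
    module

theorem factor_mul_pow (haT : a * T = T * a + S) (hST : Commute S T) {j : ℕ} (hj : j ≠ 0) :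
    (S - (1 / (j : ℝ)) • (T * a)) * T ^ j = -(1 / (j : ℝ)) • (T ^ (j + 1) * a) := by
  obtain ⟨i, rfl⟩ := Nat.exists_eq_succ_of_ne_zero hj
  have h : T * (S * T ^ i) = S * T ^ (i + 1) := by
    rw [← mul_assoc, ← hST.eq, mul_assoc, pow_succ']
  have hi : (i : ℝ) + 1 ≠ 0 := by positivity
  rw [sub_mul, smul_mul_assoc, mul_assoc, Nat.succ_eq_add_one, mul_pow_of_bracket haT hST,
    mul_add, ← mul_assoc, ← pow_succ', mul_smul_comm, h]
  push_cast
  match_scalars <;> field_simp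
  ring

/-- The composition of the factors `S - (1/j) T a` for `j = t, …, t + k - 1`. -/
def factorProd (a T S : R) (t : ℕ) : ℕ → R
  | 0 => 1
  | k + 1 => (S - (1 / ((t + k : ℕ) : ℝ)) • (T * a)) * factorProd a T S t k

theorem factorProd_mul_pow (haT : a * T = T * a + S) (hST : Commute S T) {t : ℕ} (ht : 1 ≤ t)
    (k : ℕ) :
    factorProd a T S t k * T ^ t
      = ((-1 : ℝ) ^ k * (((t - 1).factorial : ℝ) / ((t + k - 1).factorial : ℝ))) •
          (T ^ (t + k) * a ^ k) := by
  obtain ⟨s, rfl⟩ := Nat.exists_eq_add_of_le' ht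
  induction k with
  | zero => simp [factorProd, Nat.factorial_ne_zero]
  | succ k ih =>
    rw [factorProd, mul_assoc, ih, mul_smul_comm, ← mul_assoc,
      factor_mul_pow haT hST (by omega), smul_mul_assoc, mul_assoc, ← pow_succ', smul_smul]
    have h1 : s + 1 + k - 1 = s + k := by omega
    have h2 : s + 1 + (k + 1) - 1 = s + k + 1 := by omega
    have h3 : (s + 1 + k : ℕ) = s + k + 1 := by omega
    rw [h1, h2, ← add_assoc, h3, Nat.factorial_succ]
    congr 1
    have := Nat.factorial_ne_zero (s + k)
    push_cast
    field_simp
    ring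

end Factorization

section Smooth

variable (E : Type*) [NormedAddCommGroup E] [NormedSpace ℝ E]

/-- The space of smooth real functions on a normed space. -/
def smoothFun : Submodule ℝ (E → ℝ) where
  carrier := {f | ContDiff ℝ (⊤ : ℕ∞) f}
  add_mem' {f g} hf hg := by
    rw [Set.mem_ofPred_eq] at hf hg ⊢
    exact hf.add hg
  zero_mem' := by
    rw [Set.mem_ofPred_eq]
    exact contDiff_zero_fun
  smul_mem' r f hf := by
    rw [Set.mem_ofPred_eq] at hf ⊢
    exact hf.const_smul r

variable {E}

theorem contDiff_smoothFun (f : smoothFun E) : ContDiff ℝ (⊤ : ℕ∞) (f : E → ℝ) := f.2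

theorem differentiable_smoothFun (f : smoothFun E) : Differentiable ℝ (f : E → ℝ) :=
  (contDiff_smoothFun f).differentiable (by simp)

/-- The directional derivative along `v`, acting on smooth functions. -/
def dirDeriv (v : E) : Module.End ℝ (smoothFun E) where
  toFun f := ⟨fun z => fderiv ℝ (f : E → ℝ) z v, by
    exact ((contDiff_smoothFun f).fderiv_right (m := (⊤ : ℕ∞)) (by simp)).clm_apply contDiff_const⟩
  map_add' f g := by
    ext z
    simp [fderiv_add (differentiable_smoothFun f z) (differentiable_smoothFun g z)]
  map_smul' r f := by
    ext z
    simp [fderiv_const_smul (differentiable_smoothFun f z)]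

/-- Multiplication by a linear functional, acting on smooth functions. -/
def mulLin (l : E →L[ℝ] ℝ) : Module.End ℝ (smoothFun E) where
  toFun f := ⟨fun z => l z * (f : E → ℝ) z, l.contDiff.mul (contDiff_smoothFun f)⟩
  map_add' f g := by
    ext z
    simp [mul_add]
  map_smul' r f := by
    ext z
    simp [mul_left_comm]

@[simp] theorem dirDeriv_apply (v : E) (f : smoothFun E) (z : E) :
    (dirDeriv v f : E → ℝ) z = fderiv ℝ f z v := rfl

@[simp] theorem mulLin_apply (l : E →L[ℝ] ℝ) (f : smoothFun E) (z : E) :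
    (mulLin l f : E → ℝ) z = l z * (f : E → ℝ) z := rfl

theorem dirDeriv_commute (v w : E) : Commute (dirDeriv v) (dirDeriv w) := by
  ext f z
  have hd : DifferentiableAt ℝ (fderiv ℝ (f : E → ℝ)) z :=
    ((contDiff_smoothFun f).fderiv_right (m := (⊤ : ℕ∞)) (by simp)).differentiable (by simp) z
  have h (u u' : E) : fderiv ℝ (fun y => fderiv ℝ (f : E → ℝ) y u) z u'
      = fderiv ℝ (fderiv ℝ (f : E → ℝ)) z u' u := by
    rw [fderiv_clm_apply hd (differentiableAt_const _)]
    simp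
  have hs : IsSymmSndFDerivAt ℝ (f : E → ℝ) z :=
    (contDiff_smoothFun f).contDiffAt.isSymmSndFDerivAt
      (by simpa using WithTop.coe_le_coe.2 (le_top : (2 : ℕ∞) ≤ ⊤))
  exact (h w v).trans ((hs.eq v w).trans (h v w).symm)

theorem mulLin_commute (l l' : E →L[ℝ] ℝ) : Commute (mulLin l) (mulLin l') := by
  ext f z
  exact mul_left_comm _ _ _

theorem dirDeriv_mul_mulLin (v : E) (l : E →L[ℝ] ℝ) :
    dirDeriv v * mulLin l = mulLin l * dirDeriv v + l v • 1 := by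
  ext f z
  have : fderiv ℝ (fun y => l y * (f : E → ℝ) y) z v
      = l z * fderiv ℝ f z v + l v * (f : E → ℝ) z := by
    rw [fderiv_fun_mul l.differentiableAt (differentiable_smoothFun f z)]
    simp [mul_comm]
  exact this

end Smooth

section Ambient

variable {m : ℕ}

/-- Smooth functions of two ambient arguments. -/
abbrev AmbientFun (m : ℕ) := smoothFun ((Fin m → ℝ) × (Fin m → ℝ))

/-- Multiplication by `X^A` on smooth functions. -/
def smoothX (A : Fin m) : Module.End ℝ (AmbientFun m) :=
  mulLin ((ContinuousLinearMap.proj A).comp (ContinuousLinearMap.fst ℝ _ _))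

/-- Multiplication by `P^A` on smooth functions. -/
def smoothP (A : Fin m) : Module.End ℝ (AmbientFun m) :=
  mulLin ((ContinuousLinearMap.proj A).comp (ContinuousLinearMap.snd ℝ _ _))

/-- The partial derivative `∂_{X^A}` on smooth functions. -/
def smoothPdX (A : Fin m) : Module.End ℝ (AmbientFun m) := dirDeriv (Pi.single A 1, 0)

/-- The partial derivative `∂_{P^A}` on smooth functions. -/
def smoothPdP (A : Fin m) : Module.End ℝ (AmbientFun m) := dirDeriv (0, Pi.single A 1)

/-- The Thomas-D operator on smooth functions. -/
def smoothThomas (ε : Fin m → ℝ) (c : ℝ) : Fin m → Module.End ℝ (AmbientFun m) :=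
  weylThomas ε c smoothX smoothPdX

/-- The operator `P·D` on smooth functions. -/
def smoothPD (ε : Fin m → ℝ) (c : ℝ) : Module.End ℝ (AmbientFun m) :=
  ∑ A, smoothP A * smoothThomas ε c A

/-- The operator `I·D` on smooth functions. -/
def smoothID (ε : Fin m → ℝ) (c : ℝ) (I : Fin m → ℝ) : Module.End ℝ (AmbientFun m) :=
  ∑ A, I A • smoothThomas ε c A

/-- The operator `I·∂_P` on smooth functions. -/
def smoothIdP (I : Fin m → ℝ) : Module.End ℝ (AmbientFun m) := ∑ A, I A • smoothPdP A

theorem smoothX_commute (A B : Fin m) : Commute (smoothX A) (smoothX B) := mulLin_commute _ _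

theorem smoothX_commute_smoothP (A B : Fin m) : Commute (smoothX A) (smoothP B) :=
  mulLin_commute _ _

theorem smoothPdX_commute (A B : Fin m) : Commute (smoothPdX A) (smoothPdX B) :=
  dirDeriv_commute _ _

theorem smoothPdP_commute_smoothPdX (A B : Fin m) : Commute (smoothPdP A) (smoothPdX B) :=
  dirDeriv_commute _ _

theorem smoothPdX_mul_smoothX (A B : Fin m) :
    smoothPdX A * smoothX B = smoothX B * smoothPdX A + if A = B then 1 else 0 := by
  rw [smoothPdX, smoothX, dirDeriv_mul_mulLin]
  split_ifs with h <;> simp [h, eq_comm]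

theorem smoothPdX_commute_smoothP (A B : Fin m) : Commute (smoothPdX A) (smoothP B) := by
  rw [commute_iff_eq, smoothPdX, smoothP, dirDeriv_mul_mulLin]
  simp

theorem smoothPdP_commute_smoothX (A B : Fin m) : Commute (smoothPdP A) (smoothX B) := by
  rw [commute_iff_eq, smoothPdP, smoothX, dirDeriv_mul_mulLin]
  simp

theorem smoothIdP_mul_smoothP (I : Fin m → ℝ) (B : Fin m) :
    smoothIdP I * smoothP B = smoothP B * smoothIdP I + I B • 1 := by
  simp [smoothIdP, smoothPdP, smoothP, Finset.sum_mul, Finset.mul_sum, dirDeriv_mul_mulLin,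
    Finset.sum_add_distrib, Pi.single_apply, smul_add]

theorem smoothThomas_commute {ε : Fin m → ℝ} (hε : ∀ A, ε A * ε A = 1) (c : ℝ) (A B : Fin m) :
    Commute (smoothThomas ε c A) (smoothThomas ε c B) :=
  weylThomas_commute ε c hε smoothPdX_commute smoothX_commute smoothPdX_mul_smoothX A B

theorem smoothID_commute_smoothPD {ε : Fin m → ℝ} (hε : ∀ A, ε A * ε A = 1) (c : ℝ)
    (I : Fin m → ℝ) : Commute (smoothID ε c I) (smoothPD ε c) := by
  refine Commute.sum_left _ _ _ fun A _ => Commute.smul_left (Commute.sum_right _ _ _ fun B _ =>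
    Commute.mul_right ?_ (smoothThomas_commute hε c A B)) _
  exact (commute_weylThomas ε c (fun C => (smoothX_commute_smoothP C B).symm)
    (fun C => (smoothPdX_commute_smoothP C B).symm) A).symm

theorem smoothIdP_mul_smoothPD (ε : Fin m → ℝ) (c : ℝ) (I : Fin m → ℝ) :
    smoothIdP I * smoothPD ε c = smoothPD ε c * smoothIdP I + smoothID ε c I := by
  have hx (B : Fin m) : Commute (smoothIdP I) (smoothX B) :=
    Commute.sum_left _ _ _ fun C _ => (smoothPdP_commute_smoothX C B).smul_left _
  have hd (B : Fin m) : Commute (smoothIdP I) (smoothPdX B) :=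
    Commute.sum_left _ _ _ fun C _ => (smoothPdP_commute_smoothPdX C B).smul_left _
  have h (A : Fin m) : Commute (smoothIdP I) (smoothThomas ε c A) :=
    commute_weylThomas ε c hx hd A
  simp only [smoothPD, smoothID, Finset.mul_sum, Finset.sum_mul, ← Finset.sum_add_distrib]
  refine Finset.sum_congr rfl fun A _ => ?_
  rw [← mul_assoc, smoothIdP_mul_smoothP, add_mul, mul_assoc, (h A).eq, mul_assoc,
    smul_mul_assoc, one_mul]

theorem pdX_curry (A : Fin m) (f : AmbientFun m) :
    pdX A (Function.curry f) = Function.curry (smoothPdX A f) := by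
  funext x p
  have h : HasFDerivAt (fun y => (f : _ → ℝ) (y, p)) _ x :=
    (differentiable_smoothFun f (x, p)).hasFDerivAt.comp (f := fun y => (y, p)) x
      ((hasFDerivAt_id x).prodMk (hasFDerivAt_const p x))
  exact (DFunLike.congr_fun h.fderiv (Pi.single A 1)).trans (by simp [smoothPdX])

theorem pdP_curry (A : Fin m) (f : AmbientFun m) :
    pdP A (Function.curry f) = Function.curry (smoothPdP A f) := by
  funext x p
  have h : HasFDerivAt (fun q => (f : _ → ℝ) (x, q)) _ p :=
    (differentiable_smoothFun f (x, p)).hasFDerivAt.comp (f := fun q => (x, q)) p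
      ((hasFDerivAt_const x p).prodMk (hasFDerivAt_id p))
  exact (DFunLike.congr_fun h.fderiv (Pi.single A 1)).trans (by simp [smoothPdP])

theorem thomasDX_curry (ε : Fin m → ℝ) (c : ℝ) (A : Fin m) (f : AmbientFun m) :
    thomasDX ε c A (Function.curry f) = Function.curry (smoothThomas ε c A f) := by
  funext x p
  simp [thomasDX, eulerX, lapX, pdX_curry, smoothThomas, weylThomas, weylEuler, weylLap,
    smoothX, mul_assoc, Finset.mul_sum, mul_add,
    mul_left_comm]

theorem opPD_curry (ε : Fin m → ℝ) (c : ℝ) (f : AmbientFun m) :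
    opPD ε c (Function.curry f) = Function.curry (smoothPD ε c f) := by
  funext x p
  simp [opPD, thomasDX_curry, smoothPD, smoothP]

theorem opID_curry (ε : Fin m → ℝ) (c : ℝ) (I : Fin m → ℝ) (f : AmbientFun m) :
    opID ε c I (Function.curry f) = Function.curry (smoothID ε c I f) := by
  funext x p
  simp [opID, thomasDX_curry, smoothID]

theorem opIdP_curry (I : Fin m → ℝ) (f : AmbientFun m) :
    opIdP I (Function.curry f) = Function.curry (smoothIdP I f) := by
  funext x p
  simp [opIdP, pdP_curry, smoothIdP]

theorem opBcomp_curry (ε : Fin m → ℝ) (c : ℝ) (I : Fin m → ℝ) (t k : ℕ) (f : AmbientFun m) :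
    opBcomp ε c I t k (Function.curry f)
      = Function.curry (factorProd (smoothIdP I) (smoothPD ε c) (smoothID ε c I) t k f) := by
  induction k with
  | zero => rfl
  | succ k ih =>
    funext x p
    simp [opBcomp, ih, opB, opID_curry, opIdP_curry, opPD_curry, factorProd]

theorem iterate_curry {F : ((Fin m → ℝ) → (Fin m → ℝ) → ℝ) → (Fin m → ℝ) → (Fin m → ℝ) → ℝ}
    {G : Module.End ℝ (AmbientFun m)}
    (h : ∀ f : AmbientFun m, F (Function.curry f) = Function.curry (G f)) (k : ℕ)
    (f : AmbientFun m) : F^[k] (Function.curry f) = Function.curry ((G ^ k) f) := by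
  induction k with
  | zero => rfl
  | succ k ih => rw [Function.iterate_succ_apply', ih, h, pow_succ', Module.End.mul_apply]

end Ambient

/-- iterated factorization identity: as operators on smooth functions of
`(X,P)`, `𝔅_{t+k-1} ∘ ⋯ ∘ 𝔅_t ∘ (P·D)^t = (-1)^k ((t-1)!/(t+k-1)!) (P·D)^{t+k} ∘ (I·∂_P)^k`. -/
theorem iterated_factorization_identity
    (n : ℕ) (hn : 1 ≤ n) (ε : Fin (n + 2) → ℝ) (hsig : isSig ε 2)
    (I : Fin (n + 2) → ℝ) (t k : ℕ) (ht : 1 ≤ t) (hk : 1 ≤ k) :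
    ∀ Φ : (Fin (n + 2) → ℝ) → (Fin (n + 2) → ℝ) → ℝ,
      ContDiff ℝ (⊤ : ℕ∞) (Function.uncurry Φ) →
      ∀ (x p : Fin (n + 2) → ℝ),
        opBcomp ε ((n : ℝ) / 2) I t k ((opPD ε ((n : ℝ) / 2))^[t] Φ) x p
          = (-1 : ℝ) ^ k * (((t - 1).factorial : ℝ) / ((t + k - 1).factorial : ℝ)) *
              (opPD ε ((n : ℝ) / 2))^[t + k] ((opIdP I)^[k] Φ) x p := by
  intro Φ hΦ x p
  have hε (A) : ε A * ε A = 1 := by rcases hsig.1 A with h | h <;> simp [h]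
  obtain ⟨f, rfl⟩ : ∃ f : AmbientFun (n + 2), Function.curry (f : _ → ℝ) = Φ :=
    ⟨⟨Function.uncurry Φ, hΦ⟩, rfl⟩
  rw [iterate_curry (opPD_curry _ _), iterate_curry (opIdP_curry _), opBcomp_curry,
    iterate_curry (opPD_curry _ _), ← Module.End.mul_apply, ← Module.End.mul_apply,
    factorProd_mul_pow (smoothIdP_mul_smoothPD _ _ _) (smoothID_commute_smoothPD hε _ _) ht]
  rfl

end
end

section
/- Tractor form of Maxwell's equations in flat 4-dimensional space: let φ^a be a smooth vector field on ℝ⁴, set Φ₀ := (0, φ^a, −(1/2) ∂_b φ^b), and define the operator 𝔅₁Φ := −∇²Φ + (0, 0, ∂²Φ⁺) on flat tractor fields Φ = (Φ⁻, Φ^a, Φ⁺). Then 𝔅₁Φ₀ = (0, −(∂²φ^a − ∂^a ∂_b φ^b), 0); in particular 𝔅₁Φ₀ = 0 if and only if φ satisfies Maxwell's equations ∂²φ^a − ∂^a ∂_b φ^b = 0. -/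
noncomputable section

/-- Partial derivative of a function on `ℝ⁴`. -/
def pd (μ : Fin 4) (f : (Fin 4 → ℝ) → ℝ) : (Fin 4 → ℝ) → ℝ :=
  fun x => fderiv ℝ f x (Pi.single μ 1)

/-- The wave operator `∂² = η^{μν} ∂_μ ∂_ν` for the diagonal metric `ε`. -/
def lap (ε : Fin 4 → ℝ) (f : (Fin 4 → ℝ) → ℝ) : (Fin 4 → ℝ) → ℝ :=
  fun x => ∑ μ, ε μ * pd μ (pd μ f) x

/-- The divergence `∂_b φ^b` of a vector field on `ℝ⁴`. -/
def divg (φ : (Fin 4 → ℝ) → Fin 4 → ℝ) : (Fin 4 → ℝ) → ℝ :=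
  fun x => ∑ b, pd b (fun y => φ y b) x

/-- A flat tractor field on `ℝ⁴` is a smooth map into `ℝ ⊕ ℝ⁴ ⊕ ℝ`. -/
abbrev Tractor : Type := ℝ × (Fin 4 → ℝ) × ℝ

/-- The flat tractor covariant derivative
`∇_μ(Φ⁻, Φ^a, Φ⁺) = (∂_μΦ⁻ - Φ_μ, ∂_μΦ^a + δ_μ^a Φ⁺, ∂_μΦ⁺)` with `Φ_μ = η_{μa}Φ^a`. -/
def tracDeriv (ε : Fin 4 → ℝ) (μ : Fin 4) (Φ : (Fin 4 → ℝ) → Tractor) :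
    (Fin 4 → ℝ) → Tractor :=
  fun x =>
    (pd μ (fun y => (Φ y).1) x - ε μ * (Φ x).2.1 μ,
     fun a => pd μ (fun y => (Φ y).2.1 a) x + (if a = μ then (Φ x).2.2 else 0),
     pd μ (fun y => (Φ y).2.2) x)

/-- The tractor Laplacian `∇² = η^{μν} ∇_μ ∇_ν`. -/
def tracLap (ε : Fin 4 → ℝ) (Φ : (Fin 4 → ℝ) → Tractor) : (Fin 4 → ℝ) → Tractor :=
  fun x => ∑ μ, ε μ • tracDeriv ε μ (tracDeriv ε μ Φ) x

/-- The operator `𝔅₁Φ = -∇²Φ + (0, 0, ∂²Φ⁺)` on flat tractor fields. -/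
def opB1 (ε : Fin 4 → ℝ) (Φ : (Fin 4 → ℝ) → Tractor) : (Fin 4 → ℝ) → Tractor :=
  fun x => -tracLap ε Φ x + ((0 : ℝ), (0 : Fin 4 → ℝ), lap ε (fun y => (Φ y).2.2) x)

theorem ContDiff.pd {f : (Fin 4 → ℝ) → ℝ} (hf : ContDiff ℝ (⊤ : ℕ∞) f) (μ : Fin 4) :
    ContDiff ℝ (⊤ : ℕ∞) (pd μ f) :=
  (hf.fderiv_right (m := (⊤ : ℕ∞)) (by simp)).clm_apply contDiff_const

theorem ContDiff.divg {φ : (Fin 4 → ℝ) → Fin 4 → ℝ} (hφ : ContDiff ℝ (⊤ : ℕ∞) φ) :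
    ContDiff ℝ (⊤ : ℕ∞) (divg φ) :=
  ContDiff.sum fun b _ => (contDiff_pi.1 hφ b).pd b

theorem pd_const (μ : Fin 4) (c : ℝ) : pd μ (fun _ => c) = fun _ => 0 := by
  ext x
  simp [pd]

theorem pd_const_mul {f : (Fin 4 → ℝ) → ℝ} (hf : Differentiable ℝ f) (μ : Fin 4) (c : ℝ) :
    pd μ (fun y => c * f y) = fun y => c * pd μ f y := by
  ext x
  simp [pd, fderiv_const_mul (hf x)]

theorem pd_add {f g : (Fin 4 → ℝ) → ℝ} (hf : Differentiable ℝ f) (hg : Differentiable ℝ g)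
    (μ : Fin 4) : pd μ (fun y => f y + g y) = fun y => pd μ f y + pd μ g y := by
  ext x
  simp [pd, fderiv_fun_add (hf x) (hg x)]

theorem pd_ite (p : Prop) [Decidable p] (f : (Fin 4 → ℝ) → ℝ) (μ : Fin 4) :
    pd μ (fun y => if p then f y else 0) = fun y => if p then pd μ f y else 0 := by
  by_cases h : p
  · simp [h]
  · simp [h, pd_const]

/-- Two covariant derivatives in the same direction of a tractor field with vanishing top slot. -/
theorem tracDeriv_tracDeriv (ε : Fin 4 → ℝ) (μ : Fin 4) {φ : (Fin 4 → ℝ) → Fin 4 → ℝ}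
    {f : (Fin 4 → ℝ) → ℝ} (hφ : ContDiff ℝ (⊤ : ℕ∞) φ) (hf : ContDiff ℝ (⊤ : ℕ∞) f)
    (x : Fin 4 → ℝ) :
    tracDeriv ε μ (tracDeriv ε μ fun y => ((0 : ℝ), φ y, f y)) x =
      (-(ε μ * (2 * pd μ (fun y => φ y μ) x + f x)),
       fun a => pd μ (pd μ fun y => φ y a) x + (if a = μ then 2 * pd μ f x else 0),
       pd μ (pd μ f) x) := by
  have hd : ∀ a, Differentiable ℝ fun y => φ y a := fun a =>
    (contDiff_pi.1 hφ a).differentiable (by simp)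
  have hpd : ∀ a, Differentiable ℝ (pd μ fun y => φ y a) := fun a =>
    ((contDiff_pi.1 hφ a).pd μ).differentiable (by simp)
  have hite : ∀ a, Differentiable ℝ fun y => if a = μ then f y else 0 := fun a => by
    by_cases h : a = μ
    · simpa [h] using hf.differentiable (by simp)
    · simp [h]
  have htop : pd μ (fun y => 0 - ε μ * φ y μ) = fun y => -ε μ * pd μ (fun z => φ z μ) y := by
    simpa using pd_const_mul (hd μ) μ (-ε μ)
  simp only [tracDeriv, pd_const, htop, pd_add (hpd _) (hite _), pd_ite, if_true]
  refine Prod.ext (by ring) (Prod.ext (funext fun a => ?_) rfl)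
  dsimp only
  split_ifs <;> ring

/-- tractor form of Maxwell's equations in flat 4-dimensional space: for
`Φ₀ = (0, φ^a, -(1/2)∂_bφ^b)` one has `𝔅₁Φ₀ = (0, -(∂²φ^a - ∂^a∂_bφ^b), 0)`; in particular
`𝔅₁Φ₀ = 0` iff `φ` satisfies Maxwell's equations `∂²φ^a - ∂^a∂_bφ^b = 0`. -/
theorem tractor_maxwell
    (ε : Fin 4 → ℝ) (hε : ∀ a, ε a = 1 ∨ ε a = -1)
    (hsig : Nat.card {a : Fin 4 // ε a = -1} = 1)
    (φ : (Fin 4 → ℝ) → Fin 4 → ℝ) (hφ : ContDiff ℝ (⊤ : ℕ∞) φ) :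
    (∀ x : Fin 4 → ℝ,
      opB1 ε (fun y => ((0 : ℝ), φ y, -(1 / 2) * divg φ y)) x
        = ((0 : ℝ),
           fun a => -(lap ε (fun y => φ y a) x - ε a * pd a (divg φ) x),
           (0 : ℝ))) ∧
    ((∀ x : Fin 4 → ℝ,
        opB1 ε (fun y => ((0 : ℝ), φ y, -(1 / 2) * divg φ y)) x = 0) ↔
      ∀ (x : Fin 4 → ℝ) (a : Fin 4),
        lap ε (fun y => φ y a) x - ε a * pd a (divg φ) x = 0) := by
  have hf : ContDiff ℝ (⊤ : ℕ∞) fun y => -(1 / 2) * divg φ y := contDiff_const.mul hφ.divg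
  have hε2 : ∀ a, ε a * ε a = 1 := fun a => by rcases hε a with h | h <;> simp [h]
  have key : ∀ x : Fin 4 → ℝ,
      opB1 ε (fun y => ((0 : ℝ), φ y, -(1 / 2) * divg φ y)) x
        = ((0 : ℝ),
           fun a => -(lap ε (fun y => φ y a) x - ε a * pd a (divg φ) x),
           (0 : ℝ)) := fun x => by
    simp only [opB1, tracLap, tracDeriv_tracDeriv ε _ hφ hf]
    refine Prod.ext ?_ (Prod.ext (funext fun a => ?_) ?_)
    · simp only [Prod.fst_add, Prod.fst_neg, Prod.fst_sum, Prod.smul_fst, smul_eq_mul, mul_neg,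
        ← mul_assoc, hε2, one_mul, Finset.sum_neg_distrib, Finset.sum_add_distrib,
        ← Finset.mul_sum, mul_add]
      simp [divg]
      ring
    · simp only [Prod.snd_add, Prod.fst_add, Prod.snd_neg, Prod.fst_neg, Prod.snd_sum,
        Prod.fst_sum, Prod.smul_snd, Prod.smul_fst, Pi.add_apply, Pi.neg_apply, Pi.zero_apply,
        Finset.sum_apply, Pi.smul_apply, smul_eq_mul, mul_add, Finset.sum_add_distrib, mul_ite,
        mul_zero, Finset.sum_ite_eq, Finset.mem_univ, if_true, lap,
        pd_const_mul (hφ.divg.differentiable (by simp))]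
      ring
    · simp [Prod.snd_sum, lap]
  refine ⟨key, ?_⟩
  simp only [key, Prod.ext_iff, funext_iff, Prod.fst_zero, Prod.snd_zero, Pi.zero_apply,
    neg_eq_zero, true_and, and_true]

end
end
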